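/- arXiv:1506.08418 — 2 statements merged into one kernel-verified Lean document; each statement's English description precedes it below -/
import Mathlib

section
/- Every elementary abelian 2-subgroup of D(2) (i.e., every commutative subgroup in which every element squares to the identity) has order at most 8. In particular the subgroup H = ⟨c, a₁, a₃⟩ is a maximal elementary abelian 2-subgroup of D(2). -/
open DihedralGroup

abbrev D8 : Type := DihedralGroup 4

def Zc : Subgroup (D8 × D8) :=
  Subgroup.zpowers ((DihedralGroup.r 2, DihedralGroup.r 2) : D8 × D8)

lemma Zc_le_center : Zc ≤ Subgroup.center (D8 × D8) := by
  rw [Zc, Subgroup.zpowers_le]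
  exact Subgroup.mem_center_iff.mpr (by decide)

instance : Zc.Normal := ⟨by
  intro n hn g
  have h := Subgroup.mem_center_iff.mp (Zc_le_center hn) g
  have : g * n * g⁻¹ = n := by
    rw [h]; group
  rwa [this]⟩

/-- `D(2) = 2₊^{1+4}`, the central product `D₈ ∘ D₈`. -/
abbrev DTwo : Type := (D8 × D8) ⧸ Zc

def π : D8 × D8 →* DTwo := QuotientGroup.mk' Zc

lemma mem_Zc_iff (g : D8 × D8) :
    g ∈ Zc ↔ g = 1 ∨ g = (DihedralGroup.r 2, DihedralGroup.r 2) := by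
  constructor
  · intro h
    rw [Zc, Subgroup.mem_zpowers_iff] at h
    obtain ⟨k, rfl⟩ := h
    have hsq : ((DihedralGroup.r 2, DihedralGroup.r 2) : D8 × D8) ^ (2 : ℤ) = 1 := by decide
    rcases Int.even_or_odd' k with ⟨m, rfl | rfl⟩
    · left; rw [zpow_mul, hsq, one_zpow]
    · right; rw [zpow_add, zpow_mul, hsq, one_zpow, one_mul, zpow_one]
  · rintro (rfl | rfl)
    · exact one_mem _
    · exact Subgroup.mem_zpowers _

lemma commute_π_iff (g h : D8 × D8) :
    π g * π h = π h * π g ↔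
      (h * g)⁻¹ * (g * h) = 1 ∨
        (h * g)⁻¹ * (g * h) = (DihedralGroup.r 2, DihedralGroup.r 2) := by
  rw [← mem_Zc_iff, ← map_mul, ← map_mul, eq_comm]
  exact QuotientGroup.eq

lemma π_surjective : Function.Surjective π := QuotientGroup.mk'_surjective Zc

lemma card_DTwo : Nat.card DTwo = 32 := by
  have h := Subgroup.card_eq_card_quotient_mul_card_subgroup Zc
  have hz : Nat.card Zc = 2 := by
    rw [Zc, Nat.card_zpowers]
    exact orderOf_eq_prime (by decide) (by decide)
  rw [hz, Nat.card_prod, DihedralGroup.nat_card] at h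
  change _ = Nat.card DTwo * 2 at h
  omega

/-- A subgroup of `D(2)` of index at most two is not commutative. -/
lemma exists_not_commute (A : Subgroup DTwo)
    (hA : ∀ x y : DTwo, x ∉ A → y ∉ A → x * y ∈ A) :
    ∃ x ∈ A, ∃ y ∈ A, x * y ≠ y * x := by
  by_contra! hcomm
  have left_mem : ∃ u : D8, π (u, 1) ∈ A ∧ ∃ v : D8, u * v ≠ v * u := by
    by_cases h₁ : π (DihedralGroup.r 1, 1) ∈ A
    · exact ⟨_, h₁, by decide⟩
    by_cases h₂ : π (DihedralGroup.sr 0, 1) ∈ A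
    · exact ⟨_, h₂, by decide⟩
    have h₃ := hA _ _ h₁ h₂
    rw [← map_mul] at h₃
    exact ⟨_, h₃, by decide⟩
  have right_mem : ∃ u : D8, π (1, u) ∈ A ∧ ∃ v : D8, u * v ≠ v * u := by
    by_cases h₁ : π (1, DihedralGroup.r 1) ∈ A
    · exact ⟨_, h₁, by decide⟩
    by_cases h₂ : π (1, DihedralGroup.sr 0) ∈ A
    · exact ⟨_, h₂, by decide⟩
    have h₃ := hA _ _ h₁ h₂
    rw [← map_mul] at h₃
    exact ⟨_, h₃, by decide⟩
  have commute_left : ∀ u x y : D8, π (u, 1) * π (x, y) = π (x, y) * π (u, 1) →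
      u * x = x * u := by
    intro u x y h
    rw [commute_π_iff] at h
    rcases h with h | h
    · exact (inv_mul_eq_one.mp (congrArg Prod.fst h)).symm
    · have h' := congrArg Prod.snd h
      simp only [Prod.snd_mul, Prod.snd_inv, mul_one, one_mul, inv_mul_cancel] at h'
      exact absurd h' (by decide)
  have commute_right : ∀ u x y : D8, π (1, u) * π (x, y) = π (x, y) * π (1, u) →
      u * y = y * u := by
    intro u x y h
    rw [commute_π_iff] at h
    rcases h with h | h
    · exact (inv_mul_eq_one.mp (congrArg Prod.snd h)).symm
    · have h' := congrArg Prod.fst h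
      simp only [Prod.fst_mul, Prod.fst_inv, mul_one, one_mul, inv_mul_cancel] at h'
      exact absurd h' (by decide)
  obtain ⟨u, hu, v, huv⟩ := left_mem
  obtain ⟨u', hu', v', huv'⟩ := right_mem
  have hv : π (v, 1) ∉ A := fun h => huv (commute_left _ _ _ (hcomm _ hu _ h))
  have hv' : π (1, v') ∉ A := fun h => huv' (commute_right _ _ _ (hcomm _ hu' _ h))
  have h := hA _ _ hv hv'
  rw [← map_mul, Prod.mk_mul_mk, mul_one, one_mul] at h
  exact huv (commute_left _ _ _ (hcomm _ hu _ h))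

lemma card_le_eight_of_commute (A : Subgroup DTwo)
    (hcomm : ∀ x ∈ A, ∀ y ∈ A, x * y = y * x) : Nat.card A ≤ 8 := by
  by_contra! hlt
  have hmul := A.card_mul_index
  rw [card_DTwo] at hmul
  have hindex : A.index = 1 ∨ A.index = 2 := by
    have hle : A.index < 4 := by nlinarith
    interval_cases A.index <;> omega
  obtain ⟨x, hx, y, hy, hxy⟩ := exists_not_commute A <| by
    intro x y hx hy
    rcases hindex with h | h
    · simp [Subgroup.index_eq_one.mp h]
    · exact (Subgroup.mul_mem_iff_of_index_two h).mpr (iff_of_false hx hy)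
  exact hxy (hcomm x hx y hy)

set_option maxRecDepth 20000 in
lemma eq_prod_of_commute : ∀ g : D8 × D8,
    ((((DihedralGroup.sr 0, 1) : D8 × D8) * g)⁻¹ * (g * (DihedralGroup.sr 0, 1)) = 1 ∨
      (((DihedralGroup.sr 0, 1) : D8 × D8) * g)⁻¹ * (g * (DihedralGroup.sr 0, 1)) =
        (DihedralGroup.r 2, DihedralGroup.r 2)) →
    ((((1, DihedralGroup.sr 0) : D8 × D8) * g)⁻¹ * (g * (1, DihedralGroup.sr 0)) = 1 ∨
      (((1, DihedralGroup.sr 0) : D8 × D8) * g)⁻¹ * (g * (1, DihedralGroup.sr 0)) =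
        (DihedralGroup.r 2, DihedralGroup.r 2)) →
    ∃ i j k l : Fin 2, g = (DihedralGroup.r 2, 1) ^ (i : ℕ) * (DihedralGroup.sr 0, 1) ^ (j : ℕ) *
      (1, DihedralGroup.sr 0) ^ (k : ℕ) * (DihedralGroup.r 2, DihedralGroup.r 2) ^ (l : ℕ) := by
  decide


/-- Every elementary abelian 2-subgroup of `D(2)` has order at most `8`; in particular
`H = ⟨c, a₁, a₃⟩` is a maximal elementary abelian 2-subgroup. -/
theorem stmt7 :
    (∀ A : Subgroup DTwo, (∀ x ∈ A, ∀ y ∈ A, x * y = y * x) →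
      (∀ x ∈ A, x * x = 1) → Nat.card A ≤ 8) ∧
    (∀ A : Subgroup DTwo, (∀ x ∈ A, ∀ y ∈ A, x * y = y * x) →
      (∀ x ∈ A, x * x = 1) →
      Subgroup.closure {π (DihedralGroup.r 2, 1), π (DihedralGroup.sr 0, 1),
        π (1, DihedralGroup.sr 0)} ≤ A →
      A = Subgroup.closure {π (DihedralGroup.r 2, 1), π (DihedralGroup.sr 0, 1),
        π (1, DihedralGroup.sr 0)}) := by
  refine ⟨fun A hcomm _ => card_le_eight_of_commute A hcomm, fun A hcomm _ hle => ?_⟩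
  refine le_antisymm (fun x hx => ?_) hle
  obtain ⟨g, rfl⟩ := π_surjective x
  have ha₁ := hcomm _ hx _ (hle (Subgroup.subset_closure (Or.inr (Or.inl rfl))))
  have ha₃ := hcomm _ hx _ (hle (Subgroup.subset_closure (Or.inr (Or.inr rfl))))
  rw [commute_π_iff] at ha₁ ha₃
  obtain ⟨i, j, k, l, rfl⟩ := eq_prod_of_commute g ha₁ ha₃
  have hz : π (DihedralGroup.r 2, DihedralGroup.r 2) = 1 :=
    (QuotientGroup.eq_one_iff _).mpr (Subgroup.mem_zpowers _)
  rw [map_mul, map_mul, map_mul, map_pow, map_pow, map_pow, map_pow, hz, one_pow, mul_one]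
  refine mul_mem (mul_mem (pow_mem ?_ _) (pow_mem ?_ _)) (pow_mem ?_ _) <;>
    exact Subgroup.subset_closure (by simp)
end

section
/- Let A = (ℤ/2)[y₁, y₂, y₃, y₄, c]/(q₀', q₁') where q₀' = y₁y₂ + y₃y₄ and q₁' = y₁²y₂ + y₁y₂² + y₃²y₄ + y₃y₄², and let R = (ℤ/2)[x₁, x₂, x₃, x₄, w]/(q₀, q₁) where q₀ = x₁x₂ + x₃x₄ and q₁ = x₁²x₂ + x₁x₂² + x₃²x₄ + x₃x₄². Then the assignment yᵢ ↦ xᵢ², c ↦ w² induces a well-defined injective ring homomorphism φ : A → R whose image equals the set of squares {g² : g ∈ R} (the image of the Frobenius endomorphism of R). -/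
open MvPolynomial

/-- `q₀' = y₁y₂ + y₃y₄` in `(ℤ/2)[y₁, y₂, y₃, y₄, c]`, with variables
`y₁, y₂, y₃, y₄, c` encoded as `X 0, X 1, X 2, X 3, X 4`. -/
noncomputable def q0' : MvPolynomial (Fin 5) (ZMod 2) := X 0 * X 1 + X 2 * X 3

/-- `q₁' = y₁²y₂ + y₁y₂² + y₃²y₄ + y₃y₄²`. -/
noncomputable def q1' : MvPolynomial (Fin 5) (ZMod 2) :=
  X 0 ^ 2 * X 1 + X 0 * X 1 ^ 2 + X 2 ^ 2 * X 3 + X 2 * X 3 ^ 2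

/-- The ring `A = (ℤ/2)[y₁, y₂, y₃, y₄, c]/(q₀', q₁')`. -/
noncomputable def Aring := MvPolynomial (Fin 5) (ZMod 2) ⧸ Ideal.span {q0', q1'}

noncomputable instance : CommRing Aring := Ideal.Quotient.commRing _

/-- `q₀ = x₁x₂ + x₃x₄` in `(ℤ/2)[x₁, x₂, x₃, x₄, w]`, with variables
`x₁, x₂, x₃, x₄, w` encoded as `X 0, X 1, X 2, X 3, X 4`. -/
noncomputable def q0 : MvPolynomial (Fin 5) (ZMod 2) := X 0 * X 1 + X 2 * X 3

/-- `q₁ = x₁²x₂ + x₁x₂² + x₃²x₄ + x₃x₄²`. -/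
noncomputable def q1 : MvPolynomial (Fin 5) (ZMod 2) :=
  X 0 ^ 2 * X 1 + X 0 * X 1 ^ 2 + X 2 ^ 2 * X 3 + X 2 * X 3 ^ 2

/-- The ring `R = (ℤ/2)[x₁, x₂, x₃, x₄, w]/(q₀, q₁)`. -/
noncomputable def Rring := MvPolynomial (Fin 5) (ZMod 2) ⧸ Ideal.span {q0, q1}

noncomputable instance : CommRing Rring := Ideal.Quotient.commRing _

/-- In a commutative ring with `2 = 0`, squaring is a ring homomorphism. -/
def squareHom {S : Type*} [CommRing S] (h : (2 : S) = 0) : S →+* S where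
  toFun x := x ^ 2
  map_one' := one_pow 2
  map_mul' x y := mul_pow x y 2
  map_zero' := zero_pow two_ne_zero
  map_add' x y := by linear_combination x * y * h

theorem span_pair_mul_eq_inf {S : Type*} [CommRing S] {c u v : S}
    (h : ∀ b, u * b ∈ Ideal.span {c, v} → b ∈ Ideal.span {c, v}) :
    Ideal.span {c, u * v} = Ideal.span {c, u} ⊓ Ideal.span {c, v} := by
  apply le_antisymm
  · intro f hf
    obtain ⟨a, b, rfl⟩ := Ideal.mem_span_pair.1 hf
    exact ⟨Ideal.mem_span_pair.2 ⟨a, b * v, by ring⟩, Ideal.mem_span_pair.2 ⟨a, b * u, by ring⟩⟩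
  · rintro f ⟨hu, hv⟩
    obtain ⟨a, b, rfl⟩ := Ideal.mem_span_pair.1 hu
    have hb : u * b ∈ Ideal.span {c, v} := by
      have hc : a * c ∈ Ideal.span {c, v} :=
        Ideal.mul_mem_left _ _ (Ideal.subset_span (Set.mem_insert _ _))
      simpa [mul_comm] using (Ideal.add_mem_iff_right _ hc).1 hv
    obtain ⟨d, e, rfl⟩ := Ideal.mem_span_pair.1 (h b hb)
    exact Ideal.mem_span_pair.2 ⟨a + d * u, e, by ring⟩

theorem span_pair_le {S : Type*} [CommRing S] {u v : S} {J : Ideal S} (hu : u ∈ J) (hv : v ∈ J) :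
    Ideal.span {u, v} ≤ J :=
  Ideal.span_le.2 (by rintro x (rfl | rfl) <;> assumption)

/-- If a substitution `τ` kills `u` and `v`, and is the identity modulo `(u, v)`, then `(u, v)` is
the kernel of `τ`. -/
theorem span_pair_eq_ker_aeval {σ K : Type*} [CommRing K] {u v : MvPolynomial σ K}
    (τ : σ → MvPolynomial σ K) (hu : aeval τ u = 0) (hv : aeval τ v = 0)
    (h : ∀ i, X i - τ i ∈ Ideal.span {u, v}) :
    Ideal.span {u, v} = RingHom.ker (aeval τ : MvPolynomial σ K →ₐ[K] MvPolynomial σ K) := by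
  refine le_antisymm (span_pair_le hu hv) fun f hf => ?_
  have key : (Ideal.Quotient.mkₐ K (Ideal.span {u, v})).comp (aeval τ) =
      Ideal.Quotient.mkₐ K (Ideal.span {u, v}) := by
    ext i
    simpa using (Ideal.Quotient.eq.2 (h i)).symm
  have hf' := DFunLike.congr_fun key f
  rw [AlgHom.comp_apply, (RingHom.mem_ker).1 hf, map_zero] at hf'
  exact Ideal.Quotient.eq_zero_iff_mem.1 hf'.symm

theorem two_eq_zero_mvPolynomial {σ : Type*} : (2 : MvPolynomial σ (ZMod 2)) = 0 :=
  CharTwo.two_eq_zero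

theorem mem_of_mul_mem_inf {S : Type*} [CommRing S] {P Q : Ideal S} [P.IsPrime] [Q.IsPrime] {t : S}
    (hP : t ∉ P) (hQ : t ∉ Q) (b : S) (h : t * b ∈ P ⊓ Q) : b ∈ P ⊓ Q :=
  ⟨(Ideal.IsPrime.mem_or_mem ‹_› h.1).resolve_left hP,
    (Ideal.IsPrime.mem_or_mem ‹_› h.2).resolve_left hQ⟩

theorem span_pair_eq_of_eq_add_mul {S : Type*} [CommRing S] {c u v : S} (a : S)
    (h : u = v + a * c) : Ideal.span {c, u} = Ideal.span {c, v} := by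
  apply le_antisymm <;> refine span_pair_le (Ideal.subset_span (Set.mem_insert _ _)) ?_
  · exact Ideal.mem_span_pair.2 ⟨a, 1, by rw [h]; ring⟩
  · exact Ideal.mem_span_pair.2 ⟨-a, 1, by rw [h]; ring⟩

/-- `(Xᵢ, Xⱼ)` is the kernel of the substitution setting `Xᵢ` and `Xⱼ` to zero. -/
theorem span_X_X_eq_ker {σ K : Type*} [CommRing K] [DecidableEq σ] (i j : σ) :
    Ideal.span {X i, X j} = RingHom.ker (aeval (fun k => if k = i ∨ k = j then 0 else X k) :
      MvPolynomial σ K →ₐ[K] MvPolynomial σ K) := by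
  refine span_pair_eq_ker_aeval _ (by simp) (by simp) fun k => ?_
  split_ifs with hk
  · rw [sub_zero]
    exact Ideal.subset_span (by rcases hk with rfl | rfl <;> simp)
  · simp

theorem span_X_X_isPrime {σ K : Type*} [CommRing K] [IsDomain K] (i j : σ) :
    (Ideal.span {X i, X j} : Ideal (MvPolynomial σ K)).IsPrime := by
  classical
  rw [span_X_X_eq_ker]
  exact RingHom.ker_isPrime _

theorem X_notMem_span_X_X {σ K : Type*} [CommRing K] [Nontrivial K] {i j k : σ} (hi : k ≠ i)
    (hj : k ≠ j) : (X k : MvPolynomial σ K) ∉ Ideal.span {X i, X j} := by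
  classical
  rw [span_X_X_eq_ker, RingHom.mem_ker]
  simp [hi, hj]

theorem span_X_mul_eq_inf {σ K : Type*} [CommRing K] [IsDomain K] {i j k : σ} (hji : j ≠ i)
    (hjk : j ≠ k) : Ideal.span {X i, X j * X k} =
      (Ideal.span {X i, X j} ⊓ Ideal.span {X i, X k} : Ideal (MvPolynomial σ K)) :=
  span_pair_mul_eq_inf fun _ hb =>
    ((span_X_X_isPrime i k).mem_or_mem hb).resolve_left (X_notMem_span_X_X hji hjk)

theorem span_q0_X0 : Ideal.span {q0, X 0} =
    (Ideal.span {X 0, X 2} ⊓ Ideal.span {X 0, X 3} : Ideal (MvPolynomial (Fin 5) (ZMod 2))) := by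
  rw [← span_X_mul_eq_inf (by decide) (by decide), Set.pair_comm]
  exact span_pair_eq_of_eq_add_mul (X 1) (by rw [q0]; ring)

theorem span_q0_X1 : Ideal.span {q0, X 1} =
    (Ideal.span {X 1, X 2} ⊓ Ideal.span {X 1, X 3} : Ideal (MvPolynomial (Fin 5) (ZMod 2))) := by
  rw [← span_X_mul_eq_inf (by decide) (by decide), Set.pair_comm]
  exact span_pair_eq_of_eq_add_mul (X 0) (by rw [q0]; ring)

/-- The linear form `x₁ + x₂ + x₃ + x₄`. -/
noncomputable def coordSum : MvPolynomial (Fin 5) (ZMod 2) := X 0 + X 1 + X 2 + X 3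

theorem span_coordSum_X0_add_X2 : Ideal.span {coordSum, X 0 + X 2} =
    RingHom.ker (aeval ![X 2, X 3, X 2, X 3, X 4] :
      MvPolynomial (Fin 5) (ZMod 2) →ₐ[ZMod 2] MvPolynomial (Fin 5) (ZMod 2)) := by
  have h2 := two_eq_zero_mvPolynomial (σ := Fin 5)
  refine span_pair_eq_ker_aeval _ ?_ ?_ fun i => Ideal.mem_span_pair.2 ?_
  · simp [coordSum]
    linear_combination (X 2 + X 3) * h2
  · simp
    linear_combination X 2 * h2
  · fin_cases i
    · exact ⟨0, 1, by simp; linear_combination X 2 * h2⟩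
    · exact ⟨1, 1, by simp [coordSum]; linear_combination (X 0 + X 2 + X 3) * h2⟩
    all_goals exact ⟨0, 0, by simp⟩

theorem span_coordSum_X1_add_X2 : Ideal.span {coordSum, X 1 + X 2} =
    RingHom.ker (aeval ![X 3, X 2, X 2, X 3, X 4] :
      MvPolynomial (Fin 5) (ZMod 2) →ₐ[ZMod 2] MvPolynomial (Fin 5) (ZMod 2)) := by
  have h2 := two_eq_zero_mvPolynomial (σ := Fin 5)
  refine span_pair_eq_ker_aeval _ ?_ ?_ fun i => Ideal.mem_span_pair.2 ?_
  · simp [coordSum]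
    linear_combination (X 2 + X 3) * h2
  · simp
    linear_combination X 2 * h2
  · fin_cases i
    · exact ⟨1, 1, by simp [coordSum]; linear_combination (X 1 + X 2 + X 3) * h2⟩
    · exact ⟨0, 1, by simp; linear_combination X 2 * h2⟩
    all_goals exact ⟨0, 0, by simp⟩

theorem span_coordSum_X0_add_X2_isPrime : (Ideal.span {coordSum, X 0 + X 2}).IsPrime := by
  rw [span_coordSum_X0_add_X2]
  exact RingHom.ker_isPrime _

theorem span_coordSum_X1_add_X2_isPrime : (Ideal.span {coordSum, X 1 + X 2}).IsPrime := by
  rw [span_coordSum_X1_add_X2]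
  exact RingHom.ker_isPrime _

theorem X_add_X_ne_zero {σ K : Type*} [CommRing K] [Nontrivial K] {i j : σ} (h : i ≠ j) :
    (X i + X j : MvPolynomial σ K) ≠ 0 := by
  classical
  intro h0
  have := congrArg (eval fun k => if k = i then (1 : K) else 0) h0
  simp [h.symm] at this

theorem span_q0_coordSum : Ideal.span {q0, coordSum} =
    Ideal.span {coordSum, X 0 + X 2} ⊓ Ideal.span {coordSum, X 1 + X 2} := by
  rw [← span_pair_mul_eq_inf, Set.pair_comm]
  · refine span_pair_eq_of_eq_add_mul (X 2) ?_
    rw [q0, coordSum]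
    linear_combination
      -(X 0 * X 2 + X 1 * X 2 + X 2 ^ 2) * two_eq_zero_mvPolynomial (σ := Fin 5)
  · intro b hb
    refine (span_coordSum_X1_add_X2_isPrime.mem_or_mem hb).resolve_left ?_
    rw [span_coordSum_X1_add_X2, RingHom.mem_ker]
    simpa using X_add_X_ne_zero (K := ZMod 2) (show (3 : Fin 5) ≠ 2 by decide)

theorem span_q0_q1 : Ideal.span {q0, q1} =
    Ideal.span {q0, X 0} ⊓ Ideal.span {q0, X 1} ⊓ Ideal.span {q0, coordSum} := by
  rw [← span_pair_mul_eq_inf, ← span_pair_mul_eq_inf]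
  · refine span_pair_eq_of_eq_add_mul (X 2 + X 3) ?_
    rw [q0, q1, coordSum]
    linear_combination
      -(X 0 * X 1 * X 2 + X 0 * X 1 * X 3) * two_eq_zero_mvPolynomial (σ := Fin 5)
  · have := span_coordSum_X0_add_X2_isPrime
    have := span_coordSum_X1_add_X2_isPrime
    rw [span_q0_coordSum]
    apply mem_of_mul_mem_inf
    · rw [span_coordSum_X0_add_X2, RingHom.mem_ker]
      simp
    · rw [span_coordSum_X1_add_X2, RingHom.mem_ker]
      simp
  · have := span_X_X_isPrime (K := ZMod 2) (1 : Fin 5) 2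
    have := span_X_X_isPrime (K := ZMod 2) (1 : Fin 5) 3
    rw [span_q0_X1]
    exact mem_of_mul_mem_inf (X_notMem_span_X_X (by decide) (by decide))
      (X_notMem_span_X_X (by decide) (by decide))

theorem span_q0_q1_isRadical : (Ideal.span {q0, q1}).IsRadical := by
  rw [span_q0_q1, span_q0_X0, span_q0_X1, span_q0_coordSum]
  exact (((span_X_X_isPrime _ _).isRadical.inf (span_X_X_isPrime _ _).isRadical).inf
    ((span_X_X_isPrime _ _).isRadical.inf (span_X_X_isPrime _ _).isRadical)).inf
    (span_coordSum_X0_add_X2_isPrime.isRadical.inf span_coordSum_X1_add_X2_isPrime.isRadical)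

theorem two_eq_zero_Rring : (2 : Rring) = 0 := by
  have h := congrArg (Ideal.Quotient.mk (Ideal.span {q0, q1})) two_eq_zero_mvPolynomial
  rwa [map_ofNat, map_zero] at h

theorem Rring_sq_eq_zero {x : Rring} (hx : x ^ 2 = 0) : x = 0 := by
  obtain ⟨f, rfl⟩ := Ideal.Quotient.mk_surjective (I := Ideal.span {q0, q1}) x
  have hf : f ^ 2 ∈ Ideal.span {q0, q1} := by
    rw [← Ideal.Quotient.eq_zero_iff_mem, map_pow]
    exact hx
  exact Ideal.Quotient.eq_zero_iff_mem.2 (span_q0_q1_isRadical ⟨2, hf⟩)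

/-- The assignment `yᵢ ↦ xᵢ²`, `c ↦ w²` induces a well-defined injective ring
homomorphism `φ : A → R` whose image is exactly the set of squares of `R`
(the image of the Frobenius endomorphism of `R`). -/
theorem stmt13 :
    ∃ φ : Aring →+* Rring,
      (∀ i : Fin 5,
        φ (Ideal.Quotient.mk (Ideal.span {q0', q1'}) (X i)) =
          Ideal.Quotient.mk (Ideal.span {q0, q1}) (X i ^ 2)) ∧
      Function.Injective φ ∧
      Set.range φ = {x : Rring | ∃ g : Rring, g ^ 2 = x} := by
  refine ⟨(squareHom two_eq_zero_Rring : Rring →+* Rring), fun i => ?_, ?_, rfl⟩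
  · exact (map_pow (Ideal.Quotient.mk (Ideal.span {q0, q1})) (X i) 2).symm
  · exact (injective_iff_map_eq_zero (squareHom two_eq_zero_Rring)).2 fun _ => Rring_sq_eq_zero
end
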